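/- arXiv:1901.08973 — 2 statements merged into one kernel-verified Lean document; each statement's English description precedes it below -/
import Mathlib

section
/- If f : Ω → ℝ is continuous on an open set Ω ⊆ ℝⁿ and satisfies the mean value property, i.e. f(y) equals the average of f over every ball B_r(y) contained in Ω, then f is harmonic on Ω (f is C² and Δf = 0). -/
open MeasureTheory Metric

/-- The Laplacian of `f : ℝⁿ → ℝ`: sum of pure second partial derivatives. -/
noncomputable def laplacian {n : ℕ} (f : EuclideanSpace ℝ (Fin n) → ℝ)
    (x : EuclideanSpace ℝ (Fin n)) : ℝ :=
  ∑ i : Fin n, fderiv ℝ (fun y => fderiv ℝ f y (EuclideanSpace.single i 1)) x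
    (EuclideanSpace.single i 1)

open scoped Convolution ContDiff in
theorem aux_hasFDerivAt {n : ℕ} (f g : EuclideanSpace ℝ (Fin n) → ℝ)
    (hf : LocallyIntegrable f volume) (hg : ContDiff ℝ 1 g) (hc : HasCompactSupport g)
    (x v : EuclideanSpace ℝ (Fin n)) :
    fderiv ℝ (f ⋆[ContinuousLinearMap.lsmul ℝ ℝ, volume] g) x v =
      (f ⋆[ContinuousLinearMap.lsmul ℝ ℝ, volume] (fun y => fderiv ℝ g y v)) x := by
  rw [(hc.hasFDerivAt_convolution_right (ContinuousLinearMap.lsmul ℝ ℝ) hf hg x).fderiv]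
  rw [convolution_precompR_apply _ hf (hc.fderiv ℝ) (hg.continuous_fderiv (by norm_num))]

open scoped Convolution ContDiff in
theorem aux_laplacian {n : ℕ} (f g : EuclideanSpace ℝ (Fin n) → ℝ)
    (hf : LocallyIntegrable f volume) (hg : ContDiff ℝ 2 g) (hc : HasCompactSupport g)
    (x : EuclideanSpace ℝ (Fin n)) :
    laplacian (f ⋆[ContinuousLinearMap.lsmul ℝ ℝ, volume] g) x =
      (f ⋆[ContinuousLinearMap.lsmul ℝ ℝ, volume] (laplacian g)) x := by
  have h1 : ∀ v, ContDiff ℝ 1 (fun y => fderiv ℝ g y v) := fun v =>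
    (hg.fderiv_right (m := 1) (by norm_num)).clm_apply contDiff_const
  have c1 : ∀ v, HasCompactSupport (fun y => fderiv ℝ g y v) := fun v => hc.fderiv_apply ℝ v
  unfold laplacian
  have : ∀ v, (fun y => fderiv ℝ (f ⋆[ContinuousLinearMap.lsmul ℝ ℝ, volume] g) y v) =
      (f ⋆[ContinuousLinearMap.lsmul ℝ ℝ, volume] (fun y => fderiv ℝ g y v)) := fun v => by
    ext y; exact aux_hasFDerivAt f g hf (hg.of_le (by norm_num)) hc y v
  simp_rw [this]
  simp_rw [aux_hasFDerivAt f _ hf (h1 _) (c1 _)]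
  simp only [convolution_def, ContinuousLinearMap.lsmul_apply, smul_eq_mul, Finset.mul_sum]
  rw [integral_finsetSum]
  intro i _
  exact ((c1 _).fderiv_apply ℝ _).convolutionExists_right (ContinuousLinearMap.lsmul ℝ ℝ) hf
    (((h1 _).continuous_fderiv (by norm_num)).clm_apply continuous_const) x

theorem aux_radial {n : ℕ} (y : EuclideanSpace ℝ (Fin n)) (R : ℝ)
    (h : EuclideanSpace ℝ (Fin n) → ℝ) (hi : IntegrableOn h (ball y R))
    (h0 : ∀ s, 0 < s → s ≤ R → ∫ x in ball y s, h x = 0)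
    (κ : ℝ → ℝ) (hκ : ContDiff ℝ 1 κ) (hR : κ R = 0) :
    ∫ x in ball y R, h x * κ (dist x y) = 0 := by
  have hk : ∀ x ∈ ball y R, h x * κ (dist x y) = - ∫ s in Set.Ioc 0 R,
      (({p : EuclideanSpace ℝ (Fin n) × ℝ | dist p.1 y < p.2}).indicator
        (fun p => h p.1 * deriv κ p.2)) (x, s) := by
    intro x hx
    have hx : dist x y < R := hx
    have e1 : ∫ s in (dist x y)..R, deriv κ s = κ R - κ (dist x y) :=
      intervalIntegral.integral_deriv_eq_sub
        (fun s _ => (hκ.differentiable (by norm_num)) s)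
        ((hκ.continuous_deriv (by norm_num)).intervalIntegrable _ _)
    rw [intervalIntegral.integral_of_le hx.le, hR] at e1
    have e2 : ∀ s, (({p : EuclideanSpace ℝ (Fin n) × ℝ | dist p.1 y < p.2}).indicator
        (fun p => h p.1 * deriv κ p.2)) (x, s) =
        (Set.Ioi (dist x y)).indicator (fun s => h x * deriv κ s) s := by
      intro s; simp [Set.indicator]
    simp_rw [e2]
    rw [setIntegral_indicator measurableSet_Ioi]
    have e3 : Set.Ioc 0 R ∩ Set.Ioi (dist x y) = Set.Ioc (dist x y) R := by
      ext s
      simp only [Set.mem_inter_iff, Set.mem_Ioc, Set.mem_Ioi]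
      have := dist_nonneg (x := x) (y := y)
      constructor
      · rintro ⟨⟨_, b⟩, c⟩; exact ⟨c, b⟩
      · rintro ⟨c, b⟩; exact ⟨⟨by linarith, b⟩, c⟩
    rw [e3, integral_const_mul, e1]; ring
  rw [setIntegral_congr_fun measurableSet_ball hk, integral_neg, neg_eq_zero]
  rw [integral_integral_swap]
  · rw [setIntegral_congr_fun measurableSet_Ioc (g := fun _ => (0:ℝ))]
    · simp
    intro s hs
    have e2 : ∀ x, (({p : EuclideanSpace ℝ (Fin n) × ℝ | dist p.1 y < p.2}).indicator
        (fun p => h p.1 * deriv κ p.2)) (x, s) =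
        (ball y s).indicator (fun x => h x * deriv κ s) x := by
      intro x; simp [Set.indicator]
    simp only [e2]
    rw [setIntegral_indicator measurableSet_ball,
      Set.inter_eq_right.2 (ball_subset_ball hs.2), integral_mul_const, h0 s hs.1 hs.2, zero_mul]
  · refine Integrable.indicator ?_ ?_
    · refine Integrable.mul_prod hi ?_
      exact ((hκ.continuous_deriv (by norm_num)).integrableOn_Icc).mono_set Set.Ioc_subset_Icc_self
    · exact measurableSet_lt (by fun_prop) (by fun_prop)

open scoped Convolution in
theorem aux_conv {n : ℕ} (y : EuclideanSpace ℝ (Fin n)) (R : ℝ)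
    (f : EuclideanSpace ℝ (Fin n) → ℝ) (hi : Integrable f)
    (h0 : ∀ s, 0 < s → s ≤ R → f y = ⨍ x in ball y s, f x)
    (κ : ℝ → ℝ) (hκ : ContDiff ℝ 1 κ) (hR : ∀ s, R ≤ s → κ s = 0)
    (k : EuclideanSpace ℝ (Fin n) → ℝ) (hk : ∀ x, k x = κ ‖x‖) :
    (f ⋆[ContinuousLinearMap.lsmul ℝ ℝ, volume] k) y = f y * ∫ x, k x := by
  have key : ∫ x in ball y R, (f x - f y) * κ (dist x y) = 0 := by
    refine aux_radial y R _ ?_ ?_ κ hκ (hR R le_rfl)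
    · exact hi.integrableOn.sub (integrableOn_const measure_ball_lt_top.ne)
    · intro s hs hsR
      rw [integral_sub hi.integrableOn (integrableOn_const measure_ball_lt_top.ne)]
      have := h0 s hs hsR
      rw [setAverage_eq] at this
      have hv : 0 < (volume : Measure (EuclideanSpace ℝ (Fin n))).real (ball y s) :=
        ENNReal.toReal_pos (measure_ball_pos _ _ hs).ne' measure_ball_lt_top.ne
      rw [setIntegral_const]
      generalize f y = a at *
      rw [this, smul_eq_mul, smul_eq_mul, mul_inv_cancel_left₀ hv.ne', sub_self]
  rw [setIntegral_eq_integral_of_forall_compl_eq_zero] at key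
  · have hcont : Continuous fun x : EuclideanSpace ℝ (Fin n) => κ (dist x y) :=
      hκ.continuous.comp (by fun_prop)
    have hcs : HasCompactSupport fun x : EuclideanSpace ℝ (Fin n) => κ (dist x y) := by
      refine HasCompactSupport.intro (isCompact_closedBall y R) ?_
      intro x hx
      exact hR _ (by simpa using (not_le.1 hx).le)
    simp only [sub_mul] at key
    rw [integral_sub, integral_const_mul, sub_eq_zero] at key
    · rw [convolution_def]
      simp only [ContinuousLinearMap.lsmul_apply, smul_eq_mul]
      have a1 : ∀ t, k (y - t) = κ (dist t y) := fun t => by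
        rw [hk, dist_comm, dist_eq_norm]
      rw [← integral_sub_left_eq_self k volume y]
      simp only [a1]
      exact key
    · simpa [mul_comm] using hi.locallyIntegrable.integrable_smul_right_of_hasCompactSupport hcont hcs
    · exact (hcont.integrable_of_hasCompactSupport hcs).const_mul _
  · intro x hx
    rw [hR _ (by simpa using hx), mul_zero]

theorem aux_lap_radial {n : ℕ} (ψ : ℝ → ℝ) (hψ : ContDiff ℝ 2 ψ) (x : EuclideanSpace ℝ (Fin n)) :
    laplacian (fun x => ψ (‖x‖ ^ 2)) x =
      deriv (deriv ψ) (‖x‖ ^ 2) * 4 * ‖x‖ ^ 2 + 2 * n * deriv ψ (‖x‖ ^ 2) := by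
  have d1 : ∀ y : EuclideanSpace ℝ (Fin n), ∀ i, fderiv ℝ
      (fun x : EuclideanSpace ℝ (Fin n) => ψ (‖x‖ ^ 2)) y (EuclideanSpace.single i 1) =
      deriv ψ (‖y‖ ^ 2) * (2 * y i) := by
    intro y i
    have := ((hψ.differentiable (by norm_num)) (‖y‖ ^ 2)).hasDerivAt.comp_hasFDerivAt y
      (hasStrictFDerivAt_norm_sq y).hasFDerivAt
    have t := this.fderiv
    simp only [Function.comp_def] at t
    rw [t]
    simp [EuclideanSpace.inner_single_right]
  have hd : ContDiff ℝ 1 (deriv ψ) := by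
    have : ContDiff ℝ (1+1) ψ := by simpa [one_add_one_eq_two] using hψ
    exact (contDiff_succ_iff_deriv.1 this).2.2
  have d2 : ∀ i, fderiv ℝ (fun y : EuclideanSpace ℝ (Fin n) => deriv ψ (‖y‖ ^ 2) * (2 * y i)) x
      (EuclideanSpace.single i 1) = deriv (deriv ψ) (‖x‖ ^ 2) * 4 * (x i) ^ 2
        + 2 * deriv ψ (‖x‖ ^ 2) := by
    intro i
    have h1 := ((hd.differentiable (by norm_num)) (‖x‖ ^ 2)).hasDerivAt.comp_hasFDerivAt x
      (hasStrictFDerivAt_norm_sq x).hasFDerivAt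
    have h2 : HasFDerivAt (fun y : EuclideanSpace ℝ (Fin n) => 2 * y i)
        ((2:ℝ) • (EuclideanSpace.proj i : EuclideanSpace ℝ (Fin n) →L[ℝ] ℝ)) x :=
      ((EuclideanSpace.proj i : EuclideanSpace ℝ (Fin n) →L[ℝ] ℝ).hasFDerivAt).const_mul 2
    have t := (h1.mul h2).fderiv
    have e : (fun y : EuclideanSpace ℝ (Fin n) => deriv ψ (‖y‖ ^ 2) * (2 * y i)) =
      ((deriv ψ ∘ fun y : EuclideanSpace ℝ (Fin n) => ‖y‖ ^ 2) * fun y => 2 * y i) := rfl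
    rw [e, t]
    simp [EuclideanSpace.inner_single_right]
    ring
  unfold laplacian
  simp only [d1, d2]
  rw [Finset.sum_add_distrib, ← Finset.mul_sum, ← EuclideanSpace.real_norm_sq_eq]
  simp
  ring

open scoped Convolution in
theorem aux_local {n : ℕ} (x₀ : EuclideanSpace ℝ (Fin n)) (R : ℝ) (hR : 0 < R)
    (f : EuclideanSpace ℝ (Fin n) → ℝ) (hi : Integrable f)
    (h0 : ∀ y ∈ ball x₀ R, ∀ s, 0 < s → s ≤ R → f y = ⨍ x in ball y s, f x) :
    ContDiffAt ℝ 2 f x₀ ∧ laplacian f x₀ = 0 := by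
  let b : ContDiffBump (0:ℝ) := ⟨R^2/4, R^2/2, by positivity, by nlinarith [sq_pos_of_pos hR]⟩
  let ψ : ℝ → ℝ := b
  have hψ : ContDiff ℝ 3 ψ := b.contDiff
  have hψ2 : ContDiff ℝ 2 ψ := hψ.of_le (by norm_num)
  have hd : ContDiff ℝ 2 (deriv ψ) := by
    have : ContDiff ℝ (2+1) ψ := by convert hψ using 1; norm_num
    exact (contDiff_succ_iff_deriv.1 this).2.2
  have hdd : ContDiff ℝ 1 (deriv (deriv ψ)) := by
    have : ContDiff ℝ (1+1) (deriv ψ) := by convert hd using 1; norm_num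
    exact (contDiff_succ_iff_deriv.1 this).2.2
  have hz : ∀ t, R^2/2 < t → ψ =ᶠ[nhds t] fun _ => 0 := by
    intro t ht
    filter_upwards [Ioi_mem_nhds ht] with u hu
    apply b.zero_of_le_dist
    have hu : R^2/2 < u := hu
    rw [Real.dist_eq, sub_zero]
    exact hu.le.trans (le_abs_self u)
  have hz' : ∀ s, R ≤ s → R^2/2 < s^2 := fun s hs => by nlinarith
  have z0 : ∀ s, R ≤ s → ψ (s^2) = 0 := fun s hs => (hz _ (hz' s hs)).self_of_nhds
  have z1 : ∀ s, R ≤ s → deriv ψ (s^2) = 0 := fun s hs => by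
    simpa using (hz _ (hz' s hs)).deriv.self_of_nhds
  have z2 : ∀ s, R ≤ s → deriv (deriv ψ) (s^2) = 0 := fun s hs => by
    simpa using (hz _ (hz' s hs)).deriv.deriv.self_of_nhds
  set φ : EuclideanSpace ℝ (Fin n) → ℝ := fun x => ψ (‖x‖ ^ 2) with hφ
  have cφ : ContDiff ℝ 2 φ := hψ2.comp (contDiff_norm_sq ℝ)
  have sφ : HasCompactSupport φ := by
    refine HasCompactSupport.intro (isCompact_closedBall 0 R) ?_
    intro x hx
    have hx : ¬ ‖x‖ ≤ R := by simpa using hx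
    exact z0 _ (not_le.1 hx).le
  have pos : 0 < ∫ x, φ x := by
    refine cφ.continuous.integral_pos_of_hasCompactSupport_nonneg_nonzero sφ
      (fun x => b.nonneg) (x := 0) ?_
    have : ψ 0 = 1 := b.one_of_mem_closedBall (by simp [b]; positivity)
    simp [hφ, this]
  have lap0 : ∫ x, laplacian φ x = 0 := by
    have h := aux_laplacian (fun _ => (1:ℝ)) φ (locallyIntegrable_const 1) cφ sφ 0
    have e : ((fun _ => (1:ℝ)) ⋆[ContinuousLinearMap.lsmul ℝ ℝ, volume] φ) =
        fun _ => ∫ x, φ x := by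
      ext y
      rw [convolution_def]
      simp [integral_sub_left_eq_self φ volume y]
    rw [e, convolution_def] at h
    simp only [ContinuousLinearMap.lsmul_apply, smul_eq_mul, one_mul] at h
    rw [integral_sub_left_eq_self (laplacian φ) volume 0] at h
    rw [← h]
    simp [laplacian]
  have F1 : ∀ y ∈ ball x₀ R, (f ⋆[ContinuousLinearMap.lsmul ℝ ℝ, volume] φ) y =
      f y * ∫ x, φ x := fun y hy =>
    aux_conv y R f hi (h0 y hy) (fun s => ψ (s^2))
      ((hψ2.of_le (by norm_num)).comp (contDiff_id.pow 2)) z0 φ (fun _ => rfl)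
  have F2 : (f ⋆[ContinuousLinearMap.lsmul ℝ ℝ, volume] (laplacian φ)) x₀ = 0 := by
    rw [aux_conv x₀ R f hi (h0 x₀ (mem_ball_self hR))
      (fun s => deriv (deriv ψ) (s ^ 2) * 4 * s ^ 2 + 2 * n * deriv ψ (s ^ 2)) ?_ ?_ _
      (fun x => aux_lap_radial ψ hψ2 x), lap0, mul_zero]
    · have a1 : ContDiff ℝ 1 fun s : ℝ => deriv (deriv ψ) (s^2) := hdd.comp (contDiff_id.pow 2)
      have a2 : ContDiff ℝ 1 fun s : ℝ => deriv ψ (s^2) :=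
        (hd.of_le (by norm_num)).comp (contDiff_id.pow 2)
      exact ((a1.mul contDiff_const).mul (contDiff_id.pow 2)).add (contDiff_const.mul a2)
    · intro s hs
      simp only [z1 s hs, z2 s hs]; ring
  have ev : f =ᶠ[nhds x₀] fun y => (∫ x, φ x)⁻¹ *
      (f ⋆[ContinuousLinearMap.lsmul ℝ ℝ, volume] φ) y := by
    filter_upwards [ball_mem_nhds x₀ hR] with y hy
    rw [F1 y hy]; field_simp
  have cF : ContDiff ℝ 2 (f ⋆[ContinuousLinearMap.lsmul ℝ ℝ, volume] φ) :=
    sφ.contDiff_convolution_right _ hi.locallyIntegrable cφ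
  refine ⟨((contDiff_const.mul cF).contDiffAt).congr_of_eventuallyEq ev, ?_⟩
  have L := aux_laplacian f φ hi.locallyIntegrable cφ sφ x₀
  rw [F2] at L
  have e1 : laplacian f x₀ = (∫ x, φ x)⁻¹ *
      laplacian (f ⋆[ContinuousLinearMap.lsmul ℝ ℝ, volume] φ) x₀ := by
    unfold laplacian
    rw [Finset.mul_sum]
    refine Finset.sum_congr rfl fun i _ => ?_
    have e2 : (fun y => fderiv ℝ f y (EuclideanSpace.single i 1)) =ᶠ[nhds x₀]
      fun y => (∫ x, φ x)⁻¹ * fderiv ℝ (f ⋆[ContinuousLinearMap.lsmul ℝ ℝ, volume] φ) y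
        (EuclideanSpace.single i 1) := by
      filter_upwards [ev.fderiv (𝕜 := ℝ)] with y hy
      rw [hy, fderiv_const_mul (cF.differentiable (by norm_num) y)]
      rfl
    rw [e2.fderiv_eq, fderiv_const_mul]
    · rfl
    · exact ((cF.fderiv_right (m := 1) (by norm_num)).clm_apply
        contDiff_const).differentiable (by norm_num) x₀
  rw [e1, L, mul_zero]

theorem aux_laplacian_congr {n : ℕ} (f g : EuclideanSpace ℝ (Fin n) → ℝ)
    (x : EuclideanSpace ℝ (Fin n)) (h : f =ᶠ[nhds x] g) : laplacian f x = laplacian g x := by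
  unfold laplacian
  refine Finset.sum_congr rfl fun i _ => ?_
  have : (fun y => fderiv ℝ f y (EuclideanSpace.single i 1)) =ᶠ[nhds x]
      fun y => fderiv ℝ g y (EuclideanSpace.single i 1) := by
    filter_upwards [h.fderiv (𝕜 := ℝ)] with y hy
    rw [hy]
  rw [this.fderiv_eq]

/-- A continuous function on an open set satisfying the mean value property is harmonic:
it is C² and its Laplacian vanishes. -/
theorem mean_value_property_implies_harmonic {n : ℕ}
    (Ω : Set (EuclideanSpace ℝ (Fin n))) (hΩ : IsOpen Ω)
    (f : EuclideanSpace ℝ (Fin n) → ℝ) (hf : ContinuousOn f Ω)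
    (hmvp : ∀ y ∈ Ω, ∀ r > (0 : ℝ), ball y r ⊆ Ω → f y = ⨍ x in ball y r, f x) :
    ContDiffOn ℝ 2 f Ω ∧ ∀ x ∈ Ω, laplacian f x = 0 := by
  suffices H : ∀ x ∈ Ω, ContDiffAt ℝ 2 f x ∧ laplacian f x = 0 from
    ⟨fun x hx => (H x hx).1.contDiffWithinAt, fun x hx => (H x hx).2⟩
  intro x₀ hx₀
  obtain ⟨ε, hε, hsub⟩ := Metric.nhds_basis_closedBall.mem_iff.1 (hΩ.mem_nhds hx₀)
  set g := (closedBall x₀ ε).indicator f with hg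
  have gi : Integrable g := by
    rw [hg, integrable_indicator_iff measurableSet_closedBall]
    exact (hf.mono hsub).integrableOn_compact (isCompact_closedBall _ _)
  have hsub2 : ∀ y ∈ ball x₀ (ε/2), ∀ s ≤ ε/2, ball y s ⊆ closedBall x₀ ε := by
    intro y hy s hs z hz
    have hy : dist y x₀ < ε/2 := hy
    have hz : dist z y < s := hz
    have := dist_triangle z y x₀
    exact mem_closedBall.2 (by linarith)
  have ge : ∀ x ∈ closedBall x₀ ε, g x = f x := fun x hx => Set.indicator_of_mem hx f
  have hev : f =ᶠ[nhds x₀] g := by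
    filter_upwards [closedBall_mem_nhds x₀ hε] with y hy
    exact (ge y hy).symm
  obtain ⟨c, l⟩ := aux_local x₀ (ε/2) (by positivity) g gi (by
    intro y hy s hs hsR
    have hyb : y ∈ closedBall x₀ ε := hsub2 y hy s hsR (mem_ball_self hs)
    rw [ge y hyb, hmvp y (hsub hyb) s hs ((hsub2 y hy s hsR).trans hsub),
      setAverage_eq, setAverage_eq]
    congr 1
    exact setIntegral_congr_fun measurableSet_ball fun z hz => (ge z (hsub2 y hy s hsR hz)).symm)
  exact ⟨c.congr_of_eventuallyEq hev, by rw [aux_laplacian_congr f g x₀ hev, l]⟩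
end

section
/- Any function f : Ω → ℝ on an open set Ω ⊆ ℝⁿ satisfying the mean value property over all balls contained in Ω, and which is locally integrable, is infinitely differentiable on Ω. -/
open MeasureTheory Metric

namespace MVPSmooth

/-- A radial smooth bump supported in the ball of radius `ρ`. -/
noncomputable def bump {n : ℕ} (ρ : ℝ) (x : EuclideanSpace ℝ (Fin n)) : ℝ :=
  expNegInvGlue (ρ ^ 2 - ‖x‖ ^ 2)

lemma bump_contDiff {n : ℕ} (ρ : ℝ) :
    ContDiff ℝ (⊤ : ℕ∞) (bump ρ : EuclideanSpace ℝ (Fin n) → ℝ) := by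
  unfold bump
  exact expNegInvGlue.contDiff.comp (contDiff_const.sub (contDiff_norm_sq ℝ))

lemma bump_nonneg {n : ℕ} (ρ : ℝ) (x : EuclideanSpace ℝ (Fin n)) : 0 ≤ bump ρ x :=
  expNegInvGlue.nonneg _

lemma bump_lt_one {n : ℕ} (ρ : ℝ) (x : EuclideanSpace ℝ (Fin n)) : bump ρ x < 1 := by
  unfold bump expNegInvGlue
  split_ifs with h
  · norm_num
  · push Not at h
    rw [Real.exp_lt_one_iff]
    simpa using h

lemma bump_eq_zero {n : ℕ} {ρ : ℝ} (hρ : 0 < ρ) (x : EuclideanSpace ℝ (Fin n)) (h : ρ ≤ ‖x‖) :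
    bump ρ x = 0 := by
  apply expNegInvGlue.zero_of_nonpos
  nlinarith

lemma bump_hasCompactSupport {n : ℕ} {ρ : ℝ} (hρ : 0 < ρ) :
    HasCompactSupport (bump ρ : EuclideanSpace ℝ (Fin n) → ℝ) := by
  apply HasCompactSupport.intro (isCompact_closedBall 0 ρ)
  intro x hx
  apply bump_eq_zero hρ
  simp at hx
  exact hx.le

lemma bump_integral_pos {n : ℕ} {ρ : ℝ} (hρ : 0 < ρ) :
    0 < ∫ x : EuclideanSpace ℝ (Fin n), bump ρ x := by
  apply (bump_contDiff ρ).continuous.integral_pos_of_hasCompactSupport_nonneg_nonzero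
    (bump_hasCompactSupport hρ) (bump_nonneg ρ) (x := 0)
  unfold bump
  apply ne_of_gt
  apply expNegInvGlue.pos_of_pos
  simp
  positivity

lemma bump_level {n : ℕ} {ρ : ℝ} (hρ : 0 < ρ) {t : ℝ} (ht : 0 < t) (ht1 : t < 1) :
    ∃ r ≤ ρ, ∀ x : EuclideanSpace ℝ (Fin n), t < bump ρ x ↔ ‖x‖ < r := by
  have hl : Real.log t < 0 := Real.log_neg ht ht1
  have key : ∀ x : EuclideanSpace ℝ (Fin n),
      t < bump ρ x ↔ ‖x‖ ^ 2 < ρ ^ 2 + (Real.log t)⁻¹ := by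
    intro x
    unfold bump expNegInvGlue
    split_ifs with h
    · have : (Real.log t)⁻¹ < 0 := inv_lt_zero.2 hl
      constructor <;> intro h' <;> linarith
    · push Not at h
      rw [← Real.log_lt_iff_lt_exp ht, lt_neg, inv_lt_comm₀ h (by linarith), inv_neg]
      constructor <;> intro h' <;> linarith
  refine ⟨√(ρ ^ 2 + (Real.log t)⁻¹), ?_, fun x => ?_⟩
  · rw [Real.sqrt_le_left hρ.le]
    have : (Real.log t)⁻¹ < 0 := inv_lt_zero.2 hl
    linarith
  · rw [key, Real.lt_sqrt (norm_nonneg x)]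

lemma bump_integral_zero {n : ℕ} {ρ : ℝ} (hρ : 0 < ρ) (y : EuclideanSpace ℝ (Fin n))
    (g : EuclideanSpace ℝ (Fin n) → ℝ) (hg : IntegrableOn g (ball y ρ))
    (h0 : ∀ r > 0, r ≤ ρ → ∫ x in ball y r, g x = 0) :
    ∫ x in ball y ρ, bump ρ (y - x) * g x = 0 := by
  have hc : Continuous (fun x => bump ρ (y - x)) :=
    (bump_contDiff ρ).continuous.comp (continuous_const.sub continuous_id)
  let S : Set (EuclideanSpace ℝ (Fin n) × ℝ) := {p | p.2 < bump ρ (y - p.1)}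
  have hS : MeasurableSet S :=
    (isOpen_lt continuous_snd (hc.comp continuous_fst)).measurableSet
  have hint : Integrable (S.indicator (fun p => g p.1))
      ((volume.restrict (ball y ρ)).prod (volume.restrict (Set.Ioo (0 : ℝ) 1))) :=
    (hg.comp_fst _).indicator hS
  have h1 : ∀ x, bump ρ (y - x) * g x =
      ∫ t in Set.Ioo (0 : ℝ) 1, S.indicator (fun p => g p.1) (x, t) := by
    intro x
    have : ∀ t, S.indicator (fun p => g p.1) (x, t) =
        (Set.Iio (bump ρ (y - x))).indicator (fun _ => g x) t := fun t => rfl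
    simp_rw [this]
    rw [setIntegral_indicator measurableSet_Iio, setIntegral_const, Set.Ioo_inter_Iio,
      min_eq_right (bump_lt_one _ _).le]
    simp [Measure.real, bump_nonneg]
  simp_rw [h1]
  rw [integral_integral_swap (f := fun x t => S.indicator (fun p => g p.1) (x, t)) hint]
  apply setIntegral_eq_zero_of_forall_eq_zero
  intro t ht
  obtain ⟨r, hr, hr'⟩ := bump_level (n := n) hρ ht.1 ht.2
  have : ∀ x, S.indicator (fun p => g p.1) (x, t) = (ball y r).indicator g x := by
    intro x
    have hx : (x, t) ∈ S ↔ x ∈ ball y r := by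
      rw [mem_ball, dist_comm, dist_eq_norm]
      exact hr' _
    by_cases h : x ∈ ball y r
    · rw [Set.indicator_of_mem h, Set.indicator_of_mem (hx.2 h)]
    · rw [Set.indicator_of_notMem h, Set.indicator_of_notMem (fun h' => h (hx.1 h'))]
  simp_rw [this]
  rw [setIntegral_indicator measurableSet_ball,
    Set.inter_eq_right.2 (ball_subset_ball hr)]
  by_cases hr0 : 0 < r
  · exact h0 r hr0 hr
  · rw [ball_eq_empty.2 (not_lt.1 hr0)]
    simp

end MVPSmooth

open MVPSmooth Convolution in
/-- A locally integrable function satisfying the mean value property on an open set is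
infinitely differentiable there. -/
theorem mean_value_property_implies_smooth {n : ℕ}
    (Ω : Set (EuclideanSpace ℝ (Fin n))) (hΩ : IsOpen Ω)
    (f : EuclideanSpace ℝ (Fin n) → ℝ) (hf : LocallyIntegrableOn f Ω)
    (hmvp : ∀ y ∈ Ω, ∀ r > (0 : ℝ), ball y r ⊆ Ω → f y = ⨍ x in ball y r, f x) :
    ContDiffOn ℝ (⊤ : ℕ∞) f Ω := by
  intro y₀ hy₀
  apply ContDiffAt.contDiffWithinAt
  obtain ⟨R, hR, hRΩ⟩ := nhds_basis_closedBall.mem_iff.1 (hΩ.mem_nhds hy₀)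
  obtain ⟨ρ, hρ, hρR⟩ : ∃ ρ : ℝ, 0 < ρ ∧ R = 2 * ρ := ⟨R / 2, by linarith, by ring⟩
  have hfi : IntegrableOn f (closedBall y₀ R) :=
    hf.integrableOn_compact_subset hRΩ (isCompact_closedBall _ _)
  set F := (closedBall y₀ R).indicator f with hF
  have hFi : Integrable F := hfi.integrable_indicator measurableSet_closedBall
  have hconv : ContDiff ℝ (⊤ : ℕ∞)
      (bump ρ ⋆[ContinuousLinearMap.lsmul ℝ ℝ, volume] F) :=
    (bump_hasCompactSupport hρ).contDiff_convolution_left _ (bump_contDiff ρ)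
      hFi.locallyIntegrable
  set C := ∫ x : EuclideanSpace ℝ (Fin n), bump ρ x with hC
  have hCpos : 0 < C := bump_integral_pos hρ
  have hev : f =ᶠ[nhds y₀] fun y =>
      C⁻¹ * (bump ρ ⋆[ContinuousLinearMap.lsmul ℝ ℝ, volume] F) y := by
    filter_upwards [ball_mem_nhds y₀ hρ] with y hy
    have hsub : ball y ρ ⊆ closedBall y₀ R := by
      intro x hx
      rw [mem_ball] at hx hy
      rw [mem_closedBall]
      linarith [dist_triangle x y y₀]
    have hfy : IntegrableOn f (ball y ρ) := hfi.mono_set hsub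
    have hcy : IntegrableOn (fun _ => f y) (ball y ρ) :=
      integrableOn_const measure_ball_lt_top.ne
    have hzero := bump_integral_zero hρ y (fun x => f x - f y) (hfy.sub hcy) (by
      intro r hr hrρ
      have hbs : ball y r ⊆ ball y ρ := ball_subset_ball hrρ
      have hm := hmvp y (hRΩ (hsub (mem_ball_self hρ))) r hr (hbs.trans (hsub.trans hRΩ))
      rw [integral_sub (hfy.mono_set hbs) (hcy.mono_set hbs), setIntegral_const]
      rw [setAverage_eq, smul_eq_mul] at hm
      have hv : volume.real (ball y r) ≠ 0 :=
        (ENNReal.toReal_pos (measure_ball_pos _ _ hr).ne' measure_ball_lt_top.ne).ne'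
      rw [smul_eq_mul, hm]
      field_simp
      ring)
    have hc : Continuous (fun x => bump ρ (y - x)) :=
      (bump_contDiff ρ).continuous.comp (continuous_const.sub continuous_id)
    have hmul : ∀ g : EuclideanSpace ℝ (Fin n) → ℝ, IntegrableOn g (ball y ρ) →
        IntegrableOn (fun x => bump ρ (y - x) * g x) (ball y ρ) := by
      intro g hg
      refine Integrable.bdd_mul (c := 1) hg hc.aestronglyMeasurable ?_
      filter_upwards with x
      rw [Real.norm_of_nonneg (bump_nonneg _ _)]
      exact (bump_lt_one _ _).le
    have hout : ∀ x, x ∉ ball y ρ → bump ρ (y - x) = 0 := by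
      intro x hx
      apply bump_eq_zero hρ
      rw [← dist_eq_norm, dist_comm]
      simpa using hx
    have e1 : ∫ x in ball y ρ, bump ρ (y - x) * f y = C * f y := by
      rw [integral_mul_const, setIntegral_eq_integral_of_forall_compl_eq_zero hout,
        integral_sub_left_eq_self (fun x => bump ρ x) volume y]
    have e2 : (bump ρ ⋆[ContinuousLinearMap.lsmul ℝ ℝ, volume] F) y =
        ∫ x in ball y ρ, bump ρ (y - x) * f x := by
      rw [convolution_eq_swap]
      simp only [ContinuousLinearMap.lsmul_apply, smul_eq_mul]
      rw [← setIntegral_eq_integral_of_forall_compl_eq_zero (s := ball y ρ)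
        (fun x hx => by rw [hout x hx, zero_mul])]
      apply setIntegral_congr_fun measurableSet_ball
      intro x hx
      simp only [hF]
      rw [Set.indicator_of_mem (hsub hx)]
    simp_rw [mul_sub] at hzero
    rw [integral_sub (hmul f hfy) (hmul _ hcy), e1, ← e2] at hzero
    rw [sub_eq_zero.1 hzero]
    field_simp
  exact (contDiffAt_const.mul hconv.contDiffAt).congr_of_eventuallyEq hev
end
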